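/- arXiv:1602.02711 — 2 statements merged into one kernel-verified Lean document; each statement's English description precedes it below -/
import Mathlib

section
/- Let u ∈ ℝ, T > 0, and let f : ℝ → ℝ be a twice continuously differentiable nonnegative function with ∫_ℝ f(v) dv = ρ > 0, such that (v − u) f(v) + T f'(v) → 0 as |v| → ∞. If L(f)(v) = 0 for all v ∈ ℝ, then f is the Maxwellian: f(v) = (ρ / √(2πT)) exp(−(v − u)² / (2T)) for all v ∈ ℝ. -/
open Real Filter MeasureTheory

/-- A differentiable function on `ℝ` with zero derivative that tends to `a` at infinity is
identically `a`. -/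
theorem eq_of_deriv_eq_zero_of_tendsto_cocompact {g : ℝ → ℝ} {a : ℝ} (hg : Differentiable ℝ g)
    (hg' : ∀ v, deriv g v = 0) (hlim : Tendsto g (cocompact ℝ) (nhds a)) (v : ℝ) : g v = a := by
  have hconst : g = fun _ => g v := funext fun w => is_const_of_deriv_eq_zero hg hg' w v
  rw [hconst] at hlim
  exact tendsto_nhds_unique tendsto_const_nhds hlim

/-- Solutions of `(v - u) f + T f' = 0` are multiples of a Gaussian. -/
theorem eq_mul_exp_of_flux_eq_zero {u T : ℝ} (hT : T ≠ 0) {f : ℝ → ℝ} (hf : Differentiable ℝ f)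
    (hflux : ∀ v, (v - u) * f v + T * deriv f v = 0) (v : ℝ) :
    f v = f u * exp (-(v - u) ^ 2 / (2 * T)) := by
  have hderiv : ∀ w, HasDerivAt (fun w => f w * exp ((w - u) ^ 2 / (2 * T))) 0 w := by
    intro w
    have hquad : HasDerivAt (fun w => (w - u) ^ 2 / (2 * T)) ((w - u) / T) w := by
      refine ((((hasDerivAt_id w).sub_const u).pow 2).div_const (2 * T)).congr_deriv ?_
      simp only [id, Nat.cast_ofNat, Nat.add_one_sub_one, pow_one]
      field_simp
    refine ((hf w).hasDerivAt.mul hquad.exp).congr_deriv ?_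
    have h : deriv f w = -((w - u) * f w) / T := by
      field_simp
      linarith [hflux w]
    rw [h]
    ring
  have hconst := is_const_of_deriv_eq_zero (fun w => (hderiv w).differentiableAt)
    (fun w => (hderiv w).deriv) v u
  simp only [sub_self, ne_eq, OfNat.ofNat_ne_zero, not_false_eq_true, zero_pow, zero_div,
    exp_zero, mul_one] at hconst
  rw [← hconst, mul_assoc, ← exp_add, neg_div, add_neg_cancel, exp_zero, mul_one]

theorem integral_exp_neg_sub_sq_div (u T : ℝ) :
    ∫ v : ℝ, exp (-(v - u) ^ 2 / (2 * T)) = √(2 * π * T) := by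
  rw [integral_sub_right_eq_self (fun v : ℝ => exp (-v ^ 2 / (2 * T))) u]
  have hrhs : 2 * π * T = π / (1 / (2 * T)) := by
    rw [one_div, div_inv_eq_mul]
    ring
  rw [hrhs, ← integral_gaussian]
  congr with v
  ring_nf

/-- If a nonnegative `C²` function `f` with total mass `ρ > 0`, whose flux
`(v−u)f(v) + T f'(v)` vanishes at infinity, is annihilated by the linear
Fokker–Planck operator `L(f)(v) = d/dv[(v−u)f(v) + T f'(v)]`, then `f` is
the Maxwellian `ρ/√(2πT) · exp(−(v−u)²/(2T))`. -/
theorem fokker_planck_equilibrium_is_maxwellian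
    (u T ρ : ℝ) (hT : 0 < T) (hρ : 0 < ρ)
    (f : ℝ → ℝ) (hf : ContDiff ℝ 2 f) (hpos : ∀ v, 0 ≤ f v)
    (hmass : ∫ v, f v = ρ)
    (hdecay : Tendsto (fun v => (v - u) * f v + T * deriv f v) (cocompact ℝ) (nhds 0))
    (hL : ∀ v, deriv (fun w => (w - u) * f w + T * deriv f w) v = 0) :
    ∀ v : ℝ, f v = ρ / Real.sqrt (2 * Real.pi * T) * Real.exp (-(v - u) ^ 2 / (2 * T)) := by
  have hf' : Differentiable ℝ (deriv f) :=
    ((contDiff_succ_iff_deriv (n := 1)).1 (by simpa [one_add_one_eq_two] using hf)).2.2.differentiable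
      one_ne_zero
  have hfd : Differentiable ℝ f := hf.differentiable two_ne_zero
  have hsol := eq_mul_exp_of_flux_eq_zero hT.ne' hfd
    (eq_of_deriv_eq_zero_of_tendsto_cocompact (by fun_prop) hL hdecay)
  have hmass' : f u * √(2 * π * T) = ρ := by
    rw [← hmass, ← integral_exp_neg_sub_sq_div u T, ← integral_const_mul]
    exact integral_congr_ae (ae_of_all _ fun v => (hsol v).symm)
  intro v
  rw [← hmass', mul_div_cancel_right₀ _ (by positivity)]
  exact hsol v
end

section
/- Let 0 < Δt ≤ 1, ν > 0, and let u, W, e : ℤ → ℝ be such that i ↦ |u(i+1) − u(i)| and i ↦ |e(i+1) − e(i)| are summable. Let θ : ℤ → ℝ with 0 ≤ θ(i) ≤ 1 for all i, and define w : ℤ → ℝ by w(i) = (1 − Δt) u(i) − ν θ(i) (W(i) − W(i−1)) + Δt e(i). Assume that for every i ∈ ℤ there exists C_i with 0 ≤ C_i ≤ 1 − Δt and ν (W(i+1) − W(i)) = C_i (u(i+1) − u(i)). Then i ↦ |w(i+1) − w(i)| is summable and TV(w) ≤ (1 − Δt) · TV(u) + Δt · TV(e); in particular, if TV(e) ≤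 TV(u), then TV(w) ≤ TV(u). -/
/-- TVD property of the flux-limited residual equilibrium scheme
`w(i) = (1 − Δt) u(i) − ν θ(i)(W(i) − W(i−1)) + Δt e(i)` with limiter
`θ(i) ∈ [0,1]`: if for every `i` there is `C_i ∈ [0, 1 − Δt]` with
`ν(W(i+1) − W(i)) = C_i (u(i+1) − u(i))`, then
`TV(w) ≤ (1 − Δt) TV(u) + Δt TV(e)`; in particular, if `TV(e) ≤ TV(u)` then
`TV(w) ≤ TV(u)`. -/
theorem tvd_flux_limited_residual_equilibrium_scheme
    (Δt ν : ℝ) (hΔt0 : 0 < Δt) (hΔt1 : Δt ≤ 1) (hν : 0 < ν)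
    (u W e : ℤ → ℝ)
    (hu : Summable fun i : ℤ => |u (i + 1) - u i|)
    (he : Summable fun i : ℤ => |e (i + 1) - e i|)
    (θ : ℤ → ℝ) (hθ : ∀ i : ℤ, 0 ≤ θ i ∧ θ i ≤ 1)
    (w : ℤ → ℝ)
    (hw : ∀ i : ℤ, w i = (1 - Δt) * u i - ν * θ i * (W i - W (i - 1)) + Δt * e i)
    (hC : ∀ i : ℤ, ∃ C : ℝ, 0 ≤ C ∧ C ≤ 1 - Δt ∧
        ν * (W (i + 1) - W i) = C * (u (i + 1) - u i)) :
    (Summable fun i : ℤ => |w (i + 1) - w i|) ∧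
      (∑' i : ℤ, |w (i + 1) - w i|) ≤
        (1 - Δt) * (∑' i : ℤ, |u (i + 1) - u i|) + Δt * ∑' i : ℤ, |e (i + 1) - e i| ∧
      ((∑' i : ℤ, |e (i + 1) - e i|) ≤ (∑' i : ℤ, |u (i + 1) - u i|) →
        (∑' i : ℤ, |w (i + 1) - w i|) ≤ ∑' i : ℤ, |u (i + 1) - u i|) := by
  choose C hC0 hC1 hCW using hC
  set g : ℤ → ℝ := fun i => θ (i + 1) * C i * |u (i + 1) - u i| with hg
  have hcoef : ∀ i, 0 ≤ θ (i + 1) * C i ∧ θ (i + 1) * C i ≤ 1 - Δt := fun i =>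
    ⟨mul_nonneg (hθ _).1 (hC0 i),
      (mul_le_of_le_one_left (hC0 i) (hθ _).2).trans (hC1 i)⟩
  have hgs : Summable g := by
    refine Summable.of_nonneg_of_le (fun i => mul_nonneg (hcoef i).1 (abs_nonneg _))
      (fun i => ?_) hu
    exact mul_le_of_le_one_left (abs_nonneg _) (by linarith [(hcoef i).2])
  have hgs' : Summable fun i : ℤ => g (i - 1) :=
    (Equiv.subRight (1 : ℤ)).summable_iff.mpr hgs
  have hgt : ∑' i : ℤ, g (i - 1) = ∑' i, g i := (Equiv.subRight (1 : ℤ)).tsum_eq g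
  have hbound : ∀ i : ℤ, |w (i + 1) - w i| ≤
      (1 - Δt) * |u (i + 1) - u i| - g i + g (i - 1) + Δt * |e (i + 1) - e i| := by
    intro i
    have h1 := hCW i
    have h2 := hCW (i - 1)
    have h3 := hcoef (i - 1)
    simp only [hg, sub_add_cancel] at h2 h3 ⊢
    have key : w (i + 1) - w i = (1 - Δt - θ (i + 1) * C i) * (u (i + 1) - u i)
        + θ i * C (i - 1) * (u i - u (i - 1)) + Δt * (e (i + 1) - e i) := by
      rw [hw, hw, add_sub_cancel_right]
      linear_combination -θ (i + 1) * h1 + θ i * h2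
    rw [key]
    refine (abs_add_three _ _ _).trans (le_of_eq ?_)
    rw [abs_mul, abs_mul (θ i * C (i - 1)), abs_mul Δt, abs_of_nonneg h3.1,
      abs_of_pos hΔt0, abs_of_nonneg (sub_nonneg.mpr (hcoef i).2)]
    ring
  have hsum := (((hu.hasSum.mul_left (1 - Δt)).sub hgs.hasSum).add hgs'.hasSum).add
    (he.hasSum.mul_left Δt)
  have hws : Summable fun i : ℤ => |w (i + 1) - w i| :=
    Summable.of_nonneg_of_le (fun _ => abs_nonneg _) hbound hsum.summable
  have hle := hasSum_le hbound hws.hasSum hsum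
  rw [hgt, sub_add_cancel] at hle
  refine ⟨hws, hle, fun h => hle.trans ?_⟩
  linarith [mul_le_mul_of_nonneg_left h hΔt0.le]
end
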